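/- For all real x with |x| < 1 and |4x/(1+x)^2| < 1, and parameters a, b such that 2b−1 is not zero or a negative integer, the identity (1+x)^{-2a} · ₂F₁(a, b; 2b−1; 4x/(1+x)^2) = ₂F₁(a, a-b+3/2; b−1/2; x²) + (2ax/(2b−1)) · ₂F₁(a+1, a-b+3/2; b+1/2; x²) holds. -/

import Mathlib

open scoped Nat

/-- Pochhammer symbol (rising factorial). -/
noncomputable def poch (a : ℝ) (n : ℕ) : ℝ := (ascPochhammer ℝ n).eval a

/-- Gauss hypergeometric series ₂F₁(a,b;c;z). -/
noncomputable def F (a b c z : ℝ) : ℝ :=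
  ∑' n : ℕ, poch a n * poch b n / (poch c n * (n ! : ℝ)) * z ^ n

lemma poch_zero' (y : ℝ) : poch y 0 = 1 := by simp [poch]

lemma poch_succ' (y : ℝ) (n : ℕ) : poch y (n + 1) = poch y n * (y + n) := by
  simp [poch, ascPochhammer_succ_eval]

lemma poch_left (y : ℝ) (n : ℕ) : poch y (n + 1) = y * poch (y + 1) n := by
  simp [poch, ascPochhammer_succ_left]

lemma poch_ne (c : ℝ) (hc : ∀ k : ℕ, c + (k : ℝ) ≠ 0) (n : ℕ) : poch c n ≠ 0 := by
  induction n with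
  | zero => simp [poch_zero']
  | succ n ih => rw [poch_succ']; exact mul_ne_zero ih (hc n)

/-- Coefficients of `(1+x)^(-y)`. -/
noncomputable def vv (y : ℝ) (j : ℕ) : ℝ := (-1) ^ j * poch y j / (j ! : ℝ)

noncomputable def uu (a : ℝ) (k n : ℕ) : ℝ := if n ≤ k then vv (2 * a + 2 * n) (k - n) else 0

noncomputable def dd (a b : ℝ) (n : ℕ) : ℝ :=
  4 ^ n * (poch a n * poch b n / (poch (2 * b - 1) n * (n ! : ℝ)))

noncomputable def SS (a b : ℝ) (k : ℕ) : ℝ := ∑ n ∈ Finset.range (k + 1), dd a b n * uu a k n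

lemma dd_succ (a b : ℝ) (hb : ∀ k : ℕ, 2 * b - 1 + (k : ℝ) ≠ 0) (n : ℕ) :
    dd a b n * (4 * (n + a) * (n + b)) = dd a b (n + 1) * ((n + 1) * (n + 2 * b - 1)) := by
  have h1 := poch_ne _ hb n
  have h2 := hb n
  have h3 : ((n : ℝ) + 1) ≠ 0 := by positivity
  have h4 : (n ! : ℝ) ≠ 0 := by positivity
  simp only [dd, poch_succ', Nat.factorial_succ, pow_succ, Nat.cast_mul, Nat.cast_add, Nat.cast_one]
  field_simp
  ring

lemma uu_add (a : ℝ) (n j : ℕ) : uu a (n + j) n = vv (2 * a + 2 * n) j := by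
  simp [uu]

lemma uu_lt (a : ℝ) (k n : ℕ) (h : k < n) : uu a k n = 0 := by
  simp [uu, h]

lemma uu_rec (a b : ℝ) (k n : ℕ) (h : n < k + 3) :
    ((k : ℝ) + 2) * (k + 2 * b) * uu a (k + 2) n - (2 * k + 2 + 2 * a) * uu a (k + 1) n
      - (k + 2 * a) * (k + 2 * a - 2 * b + 2) * uu a k n
    = n * (n + 2 * b - 2) * (uu a (k + 2) n - uu a k n)
      - 4 * (n + a) * (n + b) * (uu a (k + 2) (n + 1) - uu a k (n + 1)) := by
  have hc : n = k + 2 ∨ n = k + 1 ∨ n = k ∨ k = n + 1 ∨ ∃ m, k = n + (m + 2) := by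
    rcases Nat.lt_or_ge k (n + 2) with h1 | h1
    · omega
    · right; right; right; right; exact ⟨k - n - 2, by omega⟩
  rcases hc with rfl | rfl | rfl | rfl | ⟨m, rfl⟩
  · rw [uu_lt a (k+1) (k+2) (by omega), uu_lt a k (k+2) (by omega), uu_lt a (k+2) (k+2+1) (by omega),
      uu_lt a k (k+2+1) (by omega)]
    push_cast
    ring
  · rw [uu_lt a k (k+1) (by omega), uu_lt a k (k+1+1) (by omega),
      show k + 2 = (k + 1) + 1 by omega, uu_add a (k+1) 1, ← Nat.add_zero (k+1+1), uu_add,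
      Nat.add_zero, ← Nat.add_zero (k+1), uu_add]
    simp [vv, poch_succ', poch_zero']
    ring
  · rw [uu_lt a n (n+1) (by omega), uu_add, uu_add, show n + 2 = n + 1 + 1 by omega, uu_add]
    have := uu_add a n 0
    rw [Nat.add_zero] at this
    rw [this]
    simp [vv, poch_succ', poch_zero']
    ring
  · rw [show n + 1 + 2 = n + 3 by omega, show n + 1 + 1 = n + 2 by omega, uu_add, uu_add, uu_add,
      show n + 3 = n + 1 + 2 by omega, uu_add]
    have := uu_add a (n+1) 0
    rw [Nat.add_zero] at this
    rw [this]
    simp [vv, poch_succ', poch_zero', Nat.factorial]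
    ring
  · rw [show n + (m + 2) + 2 = n + (m + 4) by omega, show n + (m + 2) + 1 = n + (m + 3) by omega,
      uu_add, uu_add, uu_add, show n + (m + 4) = n + 1 + (m + 3) by omega, uu_add,
      show n + (m + 2) = n + 1 + (m + 1) by omega, uu_add]
    have e1 : 2 * a + 2 * ((n + 1 : ℕ) : ℝ) = 2 * a + 2 * n + 1 + 1 := by push_cast; ring
    rw [e1]
    obtain ⟨y, hy⟩ : ∃ y, y = 2 * a + 2 * (n : ℝ) := ⟨_, rfl⟩
    have ha : a = y / 2 - n := by rw [hy]; ring
    rw [← hy]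
    simp only [vv, show m + 2 = (m + 1) + 1 by rfl, show m + 3 = (m + 1) + 1 + 1 by rfl,
      show m + 4 = (m + 1) + 1 + 1 + 1 by rfl, poch_left y, poch_left (y + 1),
      poch_succ' (y + 1 + 1), Nat.factorial_succ, pow_succ, Nat.cast_mul]
    generalize poch (y + 1 + 1) m = P
    have hf : (m ! : ℝ) ≠ 0 := by positivity
    have h1 : (m : ℝ) + 1 ≠ 0 := by positivity
    have h2 : (m : ℝ) + 1 + 1 ≠ 0 := by positivity
    have h3 : (m : ℝ) + 1 + 1 + 1 ≠ 0 := by positivity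
    have h4 : (m : ℝ) + 1 + 1 + 1 + 1 ≠ 0 := by positivity
    push_cast
    generalize (m ! : ℝ) = f at *
    generalize ((-1 : ℝ)) ^ m = s
    subst ha
    field_simp
    ring

lemma SS_ext (a b : ℝ) (k N : ℕ) (h : k + 1 ≤ N) :
    SS a b k = ∑ n ∈ Finset.range N, dd a b n * uu a k n := by
  unfold SS
  apply Finset.sum_subset
  · intro i; simp; omega
  · intro i _ hi
    rw [uu_lt a k i (by simp at hi; omega), mul_zero]

lemma SS_rec (a b : ℝ) (hb : ∀ k : ℕ, 2 * b - 1 + (k : ℝ) ≠ 0) (k : ℕ) :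
    ((k : ℝ) + 2) * (k + 2 * b) * SS a b (k + 2) = (2 * k + 2 + 2 * a) * SS a b (k + 1)
      + (k + 2 * a) * (k + 2 * a - 2 * b + 2) * SS a b k := by
  rw [SS_ext a b k (k + 3) (by omega), SS_ext a b (k + 1) (k + 3) (by omega),
    SS_ext a b (k + 2) (k + 3) (by omega)]
  have key := Finset.sum_range_sub'
    (fun n : ℕ => (n : ℝ) * (n + 2 * b - 2) * dd a b n * (uu a (k + 2) n - uu a k n)) (k + 3)
  rw [uu_lt a (k + 2) (k + 3) (by omega), uu_lt a k (k + 3) (by omega)] at key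
  have e : ∑ n ∈ Finset.range (k + 3), dd a b n * (((k : ℝ) + 2) * (k + 2 * b) * uu a (k + 2) n
      - (2 * k + 2 + 2 * a) * uu a (k + 1) n
      - (k + 2 * a) * (k + 2 * a - 2 * b + 2) * uu a k n) = 0 := by
    rw [show (0 : ℝ) = _ - _ from (by simp : (0 : ℝ) = ((0 : ℕ) : ℝ) * (((0 : ℕ) : ℝ) + 2 * b - 2)
      * dd a b 0 * (uu a (k + 2) 0 - uu a k 0) - (((k + 3 : ℕ)) : ℝ) * (((k + 3 : ℕ) : ℝ) + 2 * b - 2)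
      * dd a b (k + 3) * (0 - 0)), ← key]
    apply Finset.sum_congr rfl
    intro n hn
    rw [uu_rec a b k n (by simpa using hn)]
    have := dd_succ a b hb n
    push_cast
    linear_combination (-(uu a (k + 2) (n + 1) - uu a k (n + 1))) * this
  have e2 : ∀ n : ℕ, dd a b n * (((k : ℝ) + 2) * (k + 2 * b) * uu a (k + 2) n
      - (2 * k + 2 + 2 * a) * uu a (k + 1) n
      - (k + 2 * a) * (k + 2 * a - 2 * b + 2) * uu a k n) =
      ((k : ℝ) + 2) * (k + 2 * b) * (dd a b n * uu a (k + 2) n)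
      - (2 * k + 2 + 2 * a) * (dd a b n * uu a (k + 1) n)
      - (k + 2 * a) * (k + 2 * a - 2 * b + 2) * (dd a b n * uu a k n) := by intro n; ring
  simp only [e2, Finset.sum_sub_distrib, ← Finset.mul_sum] at e
  linarith

noncomputable def hc (a b c : ℝ) (n : ℕ) : ℝ := poch a n * poch b n / (poch c n * (n ! : ℝ))

lemma hc_succ (a b c : ℝ) (hc' : ∀ k : ℕ, c + (k : ℝ) ≠ 0) (n : ℕ) :
    hc a b c (n + 1) = hc a b c n * ((a + n) * (b + n) / ((c + n) * (n + 1))) := by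
  have h1 := poch_ne _ hc' n
  have h2 := hc' n
  have h3 : ((n : ℝ) + 1) ≠ 0 := by positivity
  have h4 : (n ! : ℝ) ≠ 0 := by positivity
  simp only [hc, poch_succ', Nat.factorial_succ, Nat.cast_mul, Nat.cast_add, Nat.cast_one]
  field_simp

lemma half_ne (b : ℝ) (hb : ∀ k : ℕ, 2 * b - 1 + (k : ℝ) ≠ 0) (k : ℕ) :
    b - 1/2 + (k : ℝ) ≠ 0 := by
  have := hb (2 * k)
  push_cast at this
  intro h; apply this; linarith

lemma half_ne' (b : ℝ) (hb : ∀ k : ℕ, 2 * b - 1 + (k : ℝ) ≠ 0) (k : ℕ) :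
    b + 1/2 + (k : ℝ) ≠ 0 := by
  have := hb (2 * k + 2)
  push_cast at this
  intro h; apply this; linarith

lemma SS_eq (a b : ℝ) (hb : ∀ k : ℕ, 2 * b - 1 + (k : ℝ) ≠ 0) (m : ℕ) :
    SS a b (2 * m) = hc a (a - b + 3/2) (b - 1/2) m ∧
    SS a b (2 * m + 1) = 2 * a / (2 * b - 1) * hc (a + 1) (a - b + 3/2) (b + 1/2) m ∧
    (b - 1/2 + m) * SS a b (2 * m + 1) = (a + m) * SS a b (2 * m) := by
  have hb0 : 2 * b - 1 ≠ 0 := by simpa using hb 0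
  induction m with
  | zero =>
    have e0 : SS a b 0 = 1 := by simp [SS, dd, uu, vv, poch_zero']
    have e1 : SS a b 1 = 2 * a / (2 * b - 1) := by
      simp [SS, Finset.sum_range_succ, dd, uu, vv, poch_zero', poch_succ']
      field_simp
      ring
    simp only [Nat.mul_zero, Nat.zero_add, e0, e1]
    refine ⟨by simp [hc, poch_zero'], by simp [hc, poch_zero'], ?_⟩
    rw [mul_one, mul_div_assoc', div_eq_iff hb0]
    push_cast
    ring
  | succ m ih =>
    obtain ⟨h1, h2, h3⟩ := ih
    have r0 := SS_rec a b hb (2 * m)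
    have r1 := SS_rec a b hb (2 * m + 1)
    have hm : ((m : ℝ) + 1) ≠ 0 := by positivity
    have n0 := half_ne b hb m
    have n1 := half_ne' b hb m
    have n2 : b + m ≠ 0 := by
      have := hb (2 * m + 1)
      push_cast at this
      intro h; apply this; linarith
    rw [show 2 * (m + 1) + 1 = 2 * m + 1 + 2 by ring, show 2 * (m + 1) = 2 * m + 2 by ring]
    rw [show 2 * m + 1 + 1 = 2 * m + 2 by ring] at r1
    have p : ((m : ℝ) + 1) * SS a b (2 * m + 2) = (a - b + 3/2 + m) * SS a b (2 * m + 1) := by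
      apply mul_left_cancel₀ n2
      push_cast at r0
      linear_combination r0 / 4 + (-(m + a - b + 1)) * h3
    have q : (b + 1/2 + m) * SS a b (2 * m + 1 + 2) = (a + m + 1) * SS a b (2 * m + 2) := by
      have n3 : (m : ℝ) + 3/2 ≠ 0 := by positivity
      apply mul_left_cancel₀ n3
      push_cast at r1
      linear_combination r1 / 4 + (-(m + a + 1/2)) * p
    refine ⟨?_, ?_, ?_⟩
    · rw [hc_succ _ _ _ (half_ne b hb), ← h1]
      have o : SS a b (2 * m) * (a + m) = (b - 1/2 + m) * SS a b (2 * m + 1) := by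
        rw [h3]; ring
      rw [← mul_div_assoc, eq_div_iff (mul_ne_zero n0 hm)]
      linear_combination (b - 1/2 + m) * p - (a - b + 3/2 + m) * o
    · rw [hc_succ _ _ _ (half_ne' b hb), ← mul_assoc, ← h2]
      rw [← mul_div_assoc, eq_div_iff (mul_ne_zero n1 hm)]
      linear_combination (m + 1) * q + (a + m + 1) * p
    · push_cast
      linear_combination q

lemma mem_ball_one (z : ℝ) (hz : |z| < 1) : z ∈ Metric.eball (0 : ℝ) 1 := by
  rw [mem_eball_zero_iff, ← ofReal_norm, Real.norm_eq_abs]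
  exact ENNReal.ofReal_lt_one.mpr hz

lemma radius_ge (a b c : ℝ) (hc' : ∀ k : ℕ, c + (k : ℝ) ≠ 0) :
    1 ≤ (ordinaryHypergeometricSeries ℝ a b c).radius := by
  by_cases ha : ∃ k : ℕ, a = -(k : ℝ)
  · obtain ⟨k, rfl⟩ := ha
    rw [ordinaryHypergeometric_radius_top_of_neg_nat₁]; exact le_top
  by_cases hb : ∃ k : ℕ, b = -(k : ℝ)
  · obtain ⟨k, rfl⟩ := hb
    rw [ordinaryHypergeometric_radius_top_of_neg_nat₂]; exact le_top
  push Not at ha hb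
  rw [ordinaryHypergeometricSeries_radius_eq_one]
  intro k
  refine ⟨fun h => ha k (by linarith), fun h => hb k (by linarith), fun h => hc' k (by linarith)⟩

lemma series_term (a b c z : ℝ) (n : ℕ) :
    (ordinaryHypergeometricSeries ℝ a b c n fun _ => z) = hc a b c n * z ^ n := by
  rw [ordinaryHypergeometricSeries_apply_eq, smul_eq_mul, hc, poch, poch, poch]
  congr 1
  rw [div_eq_mul_inv, mul_inv]
  ring

lemma F_eq (a b c z : ℝ) : F a b c z = ∑' n, hc a b c n * z ^ n := rfl

lemma hc_summable (a b c z : ℝ) (hc' : ∀ k : ℕ, c + (k : ℝ) ≠ 0) (hz : |z| < 1) :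
    Summable (fun n => hc a b c n * z ^ n) := by
  have := (ordinaryHypergeometricSeries ℝ a b c).summable (x := z)
    (Metric.eball_subset_eball (radius_ge a b c hc') (mem_ball_one z hz))
  simpa only [series_term] using this

lemma F_analytic (a b c z : ℝ) (hc' : ∀ k : ℕ, c + (k : ℝ) ≠ 0) (hz : |z| < 1) :
    AnalyticAt ℝ (F a b c) z := by
  have hr := radius_ge a b c hc'
  have h := (ordinaryHypergeometricSeries ℝ a b c).hasFPowerSeriesOnBall
    (lt_of_lt_of_le one_pos hr)
  have e : F a b c = (ordinaryHypergeometricSeries ℝ a b c).sum := by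
    funext w
    rw [F_eq, FormalMultilinearSeries.sum]
    simp only [series_term]
  rw [e]
  exact h.analyticOnNhd _ (Metric.eball_subset_eball hr (mem_ball_one z hz))

lemma choose_eq_vv (y : ℝ) (j : ℕ) : Ring.choose (-y) j = vv y j := by
  have h4 : (j ! : ℝ) ≠ 0 := by positivity
  have h := Ring.factorial_nsmul_multichoose_eq_ascPochhammer y j
  rw [Polynomial.ascPochhammer_smeval_eq_eval, nsmul_eq_mul] at h
  rw [Ring.choose_neg', vv, poch, ← h]
  field_simp
  rcases Nat.even_or_odd j with hj | hj
  · rw [Int.negOnePow_even _ (by exact_mod_cast hj), hj.neg_one_pow]; simp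
  · rw [Int.negOnePow_odd _ (by exact_mod_cast hj), hj.neg_one_pow]; simp

lemma binom_hasSum (y x : ℝ) (hx : |x| < 1) :
    HasSum (fun j => vv y j * x ^ j) ((1 + x) ^ (-y)) := by
  have := (Real.one_add_rpow_hasFPowerSeriesOnBall_zero (a := -y)).hasSum (mem_ball_one x hx)
  simp only [binomialSeries_apply, choose_eq_vv, List.ofFn_const, List.prod_replicate,
    smul_eq_mul, zero_add] at this
  exact this

lemma poch_abs (y : ℝ) (N : ℕ) (hy : |y| ≤ N) (j : ℕ) : |poch y j| ≤ poch N j := by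
  induction j with
  | zero => simp [poch_zero']
  | succ j ih =>
    rw [poch_succ', poch_succ', abs_mul]
    have : |y + j| ≤ N + j := (abs_add_le _ _).trans (by simpa using hy)
    exact mul_le_mul ih this (abs_nonneg _) ((abs_nonneg _).trans ih)

lemma vv_abs (y : ℝ) (N : ℕ) (hy : |y| ≤ N) (j : ℕ) : |vv y j| ≤ 2 ^ (N + j) := by
  have h4 : (0 : ℝ) < (j ! : ℝ) := by positivity
  have h := poch_abs y N hy j
  rw [poch, poch, ascPochhammer_nat_eq_natCast_ascFactorial,
    Nat.ascFactorial_eq_factorial_mul_choose'] at h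
  rw [vv, abs_div, abs_mul, abs_pow, abs_neg, abs_one, one_pow, one_mul, abs_of_pos h4,
    div_le_iff₀ h4, poch]
  refine h.trans ?_
  push_cast
  rw [mul_comm]
  gcongr
  have h5 : (N + j - 1).choose j ≤ 2 ^ (N + j) :=
    (Nat.choose_le_two_pow _ _).trans (Nat.pow_le_pow_right (by norm_num) (by omega))
  exact_mod_cast h5

lemma hc_bound (a b c : ℝ) (hc' : ∀ k : ℕ, c + (k : ℝ) ≠ 0) :
    ∃ C : ℝ, 0 ≤ C ∧ ∀ n, |hc a b c n| ≤ C * 2 ^ n := by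
  have hs := hc_summable a b c (1/2) hc' (by rw [abs_of_pos] <;> norm_num)
  obtain ⟨C, hC⟩ := hs.tendsto_atTop_zero.norm.bddAbove_range
  have hC' : ∀ n, |hc a b c n * (1/2) ^ n| ≤ C := fun n => hC ⟨n, rfl⟩
  refine ⟨C, (abs_nonneg _).trans (hC' 0), fun n => ?_⟩
  have := hC' n
  rw [abs_mul, abs_of_pos (by positivity : (0 : ℝ) < (1/2) ^ n), one_div, inv_pow,
    ← div_eq_mul_inv, div_le_iff₀ (by positivity)] at this
  exact this

noncomputable def ff (a b x : ℝ) (p : ℕ × ℕ) : ℝ :=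
  dd a b p.1 * x ^ p.1 * (vv (2 * a + 2 * p.1) p.2 * x ^ p.2)

lemma ff_summable (a b x : ℝ) (hb : ∀ k : ℕ, 2 * b - 1 + (k : ℝ) ≠ 0) (hx : |x| < 1/64) :
    Summable (ff a b x) := by
  obtain ⟨C, hC0, hC⟩ := hc_bound a b (2 * b - 1) hb
  obtain ⟨A, hA⟩ := exists_nat_ge |2 * a|
  have s1 : Summable (fun n : ℕ => C * 2 ^ A * (32 * |x|) ^ n) :=
    (summable_geometric_of_lt_one (by positivity) (by linarith)).mul_left _
  have s2 : Summable (fun n : ℕ => (2 * |x|) ^ n) :=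
    summable_geometric_of_lt_one (by positivity) (by linarith)
  have s := s1.mul_of_nonneg s2 (fun n => by dsimp; positivity) (fun n => by dsimp; positivity)
  refine Summable.of_norm_bounded s ?_
  rintro ⟨n, j⟩
  have h1 : |vv (2 * a + 2 * n) j| ≤ 2 ^ (A + 2 * n + j) := by
    apply vv_abs
    refine (abs_add_le _ _).trans ?_
    push_cast
    rw [abs_of_nonneg (by positivity : (0 : ℝ) ≤ 2 * n)]
    linarith
  have h2 : |dd a b n| ≤ 4 ^ n * (C * 2 ^ n) := by
    have e : dd a b n = 4 ^ n * hc a b (2 * b - 1) n := rfl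
    rw [e, abs_mul, abs_of_pos (by positivity : (0 : ℝ) < 4 ^ n)]
    gcongr
    exact hC n
  simp only [ff, Real.norm_eq_abs, abs_mul, abs_pow]
  calc |dd a b n| * |x| ^ n * (|vv (2 * a + 2 * n) j| * |x| ^ j)
      ≤ (4 ^ n * (C * 2 ^ n)) * |x| ^ n * (2 ^ (A + 2 * n + j) * |x| ^ j) := by gcongr
    _ = C * 2 ^ A * (32 * |x|) ^ n * (2 * |x|) ^ j := by
      rw [pow_add, pow_add, pow_mul, mul_pow, mul_pow, show (32 : ℝ) = 4 * 2 * 2 ^ 2 by norm_num,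
        mul_pow, mul_pow]
      ring

lemma ff_tsum_left (a b x : ℝ) (hb : ∀ k : ℕ, 2 * b - 1 + (k : ℝ) ≠ 0) (hx : |x| < 1/64) :
    ∑' p, ff a b x p = (1 + x) ^ (-(2 * a)) * F a b (2 * b - 1) (4 * x / (1 + x) ^ 2) := by
  have hx1 : |x| < 1 := by linarith
  have h0 : 0 < 1 + x := by linarith [(abs_lt.mp hx1).1]
  rw [(ff_summable a b x hb hx).tsum_prod, F_eq, ← tsum_mul_left]
  apply tsum_congr
  intro n
  simp only [ff]
  rw [tsum_mul_left, (binom_hasSum _ x hx1).tsum_eq, neg_add, Real.rpow_add h0,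
    show -(2 * (n : ℝ)) = -((2 * n : ℕ) : ℝ) by push_cast; ring, Real.rpow_neg h0.le (_ : ℕ),
    Real.rpow_natCast, pow_mul, div_pow, mul_pow]
  have e : dd a b n = 4 ^ n * hc a b (2 * b - 1) n := rfl
  rw [e]
  field_simp

lemma ff_tsum_right (a b x : ℝ) (hb : ∀ k : ℕ, 2 * b - 1 + (k : ℝ) ≠ 0) (hx : |x| < 1/64) :
    ∑' p, ff a b x p = ∑' k, SS a b k * x ^ k := by
  have hs := ff_summable a b x hb hx
  rw [← Finset.HasAntidiagonal.sigmaAntidiagonalEquivProd.tsum_eq]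
  have hs' := Finset.HasAntidiagonal.sigmaAntidiagonalEquivProd.summable_iff.mpr hs
  refine (Summable.tsum_sigma' (fun k => (hasSum_fintype _).summable) hs').trans ?_
  apply tsum_congr
  intro k
  rw [tsum_fintype, SS, Finset.sum_mul]
  simp only [Function.comp_apply, Finset.HasAntidiagonal.sigmaAntidiagonalEquivProd_apply]
  rw [Finset.sum_coe_sort (Finset.HasAntidiagonal.antidiagonal k) (ff a b x),
    Finset.Nat.sum_antidiagonal_eq_sum_range_succ_mk]
  apply Finset.sum_congr rfl
  intro n hn
  have hn' : n ≤ k := by simpa [Nat.lt_succ_iff] using hn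
  simp only [ff, uu, if_pos hn']
  rw [← Nat.add_sub_cancel' hn', pow_add]
  simp only [Nat.add_sub_cancel_left]
  ring

lemma SS_tsum (a b x : ℝ) (hb : ∀ k : ℕ, 2 * b - 1 + (k : ℝ) ≠ 0) (hx : |x| < 1) :
    ∑' k, SS a b k * x ^ k = F a (a - b + 3/2) (b - 1/2) (x ^ 2)
        + (2 * a * x / (2 * b - 1)) * F (a + 1) (a - b + 3/2) (b + 1/2) (x ^ 2) := by
  have hx2 : |x ^ 2| < 1 := by
    rw [abs_pow]; exact pow_lt_one₀ (abs_nonneg _) hx (by norm_num)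
  have s1 := (hc_summable a (a - b + 3/2) (b - 1/2) (x ^ 2) (half_ne b hb) hx2).hasSum
  have s2 := ((hc_summable (a + 1) (a - b + 3/2) (b + 1/2) (x ^ 2)
    (half_ne' b hb) hx2).hasSum).mul_left (2 * a * x / (2 * b - 1))
  rw [← F_eq] at s1 s2
  refine (HasSum.even_add_odd ?_ ?_).tsum_eq
  · refine (congrArg (fun h => HasSum h _) (funext ?_)).mpr s1
    intro m
    rw [(SS_eq a b hb m).1, pow_mul]
  · refine (congrArg (fun h => HasSum h _) (funext ?_)).mpr s2
    intro m
    rw [(SS_eq a b hb m).2.1, pow_succ, pow_mul]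
    ring

theorem rathie_kim_second (a b : ℝ) (hb : ∀ k : ℕ, 2 * b - 1 + (k : ℝ) ≠ 0)
    (x : ℝ) (hx : |x| < 1) (hx2 : |4 * x / (1 + x) ^ 2| < 1) :
    (1 + x) ^ (-(2 * a)) * F a b (2 * b - 1) (4 * x / (1 + x) ^ 2) =
      F a (a - b + 3/2) (b - 1/2) (x ^ 2)
        + (2 * a * x / (2 * b - 1)) * F (a + 1) (a - b + 3/2) (b + 1/2) (x ^ 2) := by
  have hxl := (abs_lt.mp hx).1
  have hxu := (abs_lt.mp hx).2
  have hseg : ∀ t ∈ Set.uIcc 0 x, |t| < 1 ∧ |4 * t / (1 + t) ^ 2| < 1 := by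
    intro t ht
    rw [abs_lt, div_lt_iff₀ (by nlinarith), lt_div_iff₀ (by nlinarith)] at hx2
    rw [Set.mem_uIcc] at ht
    have ht1 : -1 < t ∧ t < 1 := by
      rcases ht with h | h <;> constructor <;> linarith
    refine ⟨abs_lt.mpr ht1, ?_⟩
    have hp : 0 < (1 + t) ^ 2 := by nlinarith
    rw [abs_lt, div_lt_iff₀ hp, lt_div_iff₀ hp]
    constructor
    · rcases ht with h | h <;> nlinarith
    · nlinarith
  let f : ℝ → ℝ := fun t => (1 + t) ^ (-(2 * a)) * F a b (2 * b - 1) (4 * t / (1 + t) ^ 2)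
  let g : ℝ → ℝ := fun t => F a (a - b + 3/2) (b - 1/2) (t ^ 2)
        + (2 * a * t / (2 * b - 1)) * F (a + 1) (a - b + 3/2) (b + 1/2) (t ^ 2)
  have hf : AnalyticOnNhd ℝ f (Set.uIcc 0 x) := by
    intro t ht
    obtain ⟨h1, h2⟩ := hseg t ht
    have h0 : 0 < 1 + t := by linarith [(abs_lt.mp h1).1]
    have hz : AnalyticAt ℝ (fun t : ℝ => 4 * t / (1 + t) ^ 2) t := by
      apply AnalyticAt.div
      · fun_prop
      · fun_prop
      · positivity
    apply AnalyticAt.mul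
    · exact Real.one_add_rpow_hasFPowerSeriesOnBall_zero.analyticOnNhd _ (mem_ball_one t h1)
    · exact AnalyticAt.fun_comp (f := fun t : ℝ => 4 * t / (1 + t) ^ 2)
        (F_analytic a b (2 * b - 1) _ hb h2) hz
  have hg : AnalyticOnNhd ℝ g (Set.uIcc 0 x) := by
    intro t ht
    obtain ⟨h1, h2⟩ := hseg t ht
    have ht2 : |t ^ 2| < 1 := by
      rw [abs_pow]; exact pow_lt_one₀ (abs_nonneg _) h1 (by norm_num)
    have hz : AnalyticAt ℝ (fun t : ℝ => t ^ 2) t := by fun_prop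
    apply AnalyticAt.add
    · exact AnalyticAt.fun_comp (f := fun t : ℝ => t ^ 2)
        (F_analytic _ _ _ _ (half_ne b hb) ht2) hz
    apply AnalyticAt.mul
    · have : (fun t : ℝ => 2 * a * t / (2 * b - 1)) = fun t => (2 * a / (2 * b - 1)) * t := by
        funext t; ring
      rw [this]; fun_prop
    · exact AnalyticAt.fun_comp (f := fun t : ℝ => t ^ 2)
        (F_analytic _ _ _ _ (half_ne' b hb) ht2) hz
  have hfg : f =ᶠ[nhds 0] g := by
    filter_upwards [Metric.ball_mem_nhds (0 : ℝ) (by norm_num : (0 : ℝ) < 1/64)] with t ht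
    have ht' : |t| < 1/64 := by simpa using ht
    simp only [f, g]
    rw [← ff_tsum_left a b t hb ht', ff_tsum_right a b t hb ht', SS_tsum a b t hb (by linarith)]
  exact hf.eqOn_of_preconnected_of_eventuallyEq hg isPreconnected_uIcc Set.left_mem_uIcc hfg
    Set.right_mem_uIcc
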